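/- arXiv:math/0407248 — 2 statements merged into one kernel-verified Lean document; each statement's English description precedes it below -/
import Mathlib

section
/- Let u : ℂ → ℝ be a twice continuously differentiable function, and write u_z, u_{z̄}, u_{zz̄} for its Wirtinger derivatives. For ζ ∈ ℂ* define the 2×2 complex matrices U_ζ = [[u_z, e^{-2u}ζ^{-1}], [e^{2u}ζ^{-1}, -u_z]] and V_ζ = [[u_{z̄}, e^{2u}ζ], [e^{-2u}ζ, -u_{z̄}]] (so that V_ζ is the Hermitian transpose of U evaluated at ζ̄^{-1}). Then the zero-curvature equation ∂_z V_ζ + ∂_{z̄} U_ζ = U_ζ V_ζ − V_ζ U_ζ holds at a point for every ζ ∈ ℂ* if and only if the elliptic sinh-Gordon equation u_{zz̄} + sinh(4u) = 0 holds at that point. -/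
/-- The Wirtinger derivative `∂_z f = (∂_x f - i ∂_y f)/2` of a function `f : ℂ → ℂ`. -/
noncomputable def wdz (f : ℂ → ℂ) (z : ℂ) : ℂ :=
  (fderiv ℝ f z 1 - Complex.I * fderiv ℝ f z Complex.I) / 2

/-- The Wirtinger derivative `∂_{z̄} f = (∂_x f + i ∂_y f)/2` of a function `f : ℂ → ℂ`. -/
noncomputable def wdzbar (f : ℂ → ℂ) (z : ℂ) : ℂ :=
  (fderiv ℝ f z 1 + Complex.I * fderiv ℝ f z Complex.I) / 2

/-- `U_ζ = [[u_z, e^{-2u} ζ⁻¹], [e^{2u} ζ⁻¹, -u_z]]`. -/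
noncomputable def Umat (u : ℂ → ℝ) (ζ z : ℂ) : Matrix (Fin 2) (Fin 2) ℂ :=
  !![wdz (fun w => (u w : ℂ)) z, (Real.exp (-2 * u z) : ℂ) * ζ⁻¹;
     (Real.exp (2 * u z) : ℂ) * ζ⁻¹, -wdz (fun w => (u w : ℂ)) z]

/-- `V_ζ = [[u_{z̄}, e^{2u} ζ], [e^{-2u} ζ, -u_{z̄}]]`, the Hermitian transpose of `U`
evaluated at `ζ̄⁻¹`. -/
noncomputable def Vmat (u : ℂ → ℝ) (ζ z : ℂ) : Matrix (Fin 2) (Fin 2) ℂ :=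
  !![wdzbar (fun w => (u w : ℂ)) z, (Real.exp (2 * u z) : ℂ) * ζ;
     (Real.exp (-2 * u z) : ℂ) * ζ, -wdzbar (fun w => (u w : ℂ)) z]

lemma aux_contDiff (u : ℂ → ℝ) (hu : ContDiff ℝ 2 u) : ContDiff ℝ 2 (fun w => (u w : ℂ)) :=
  Complex.ofRealCLM.contDiff.comp hu

lemma aux_fderiv_apply (f : ℂ → ℂ) (hf : ContDiff ℝ 2 f) (z v : ℂ) :
    HasFDerivAt (fun w => fderiv ℝ f w v) ((fderiv ℝ (fderiv ℝ f) z).flip v) z := by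
  have h1 : ContDiff ℝ 1 (fderiv ℝ f) := hf.fderiv_right (by norm_num)
  have h2 : HasFDerivAt (fderiv ℝ f) (fderiv ℝ (fderiv ℝ f) z) z :=
    (h1.differentiable (by norm_num) z).hasFDerivAt
  have h3 := h2.clm_apply (hasFDerivAt_const v z)
  have e : fderiv ℝ f z ∘SL (0 : ℂ →L[ℝ] ℂ) + (fderiv ℝ (fderiv ℝ f) z).flip v
      = (fderiv ℝ (fderiv ℝ f) z).flip v := by simp
  exact e ▸ h3

lemma aux_wdz (f : ℂ → ℂ) (hf : ContDiff ℝ 2 f) (z : ℂ) :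
    HasFDerivAt (wdz f) ((2⁻¹ : ℂ) • ((fderiv ℝ (fderiv ℝ f) z).flip 1
      - Complex.I • (fderiv ℝ (fderiv ℝ f) z).flip Complex.I)) z := by
  have h := ((aux_fderiv_apply f hf z 1).sub
    ((aux_fderiv_apply f hf z Complex.I).const_smul Complex.I)).const_smul (2⁻¹ : ℂ)
  refine h.congr_of_eventuallyEq (Filter.Eventually.of_forall fun w => ?_)
  simp [wdz]
  ring

lemma aux_wdzbar (f : ℂ → ℂ) (hf : ContDiff ℝ 2 f) (z : ℂ) :
    HasFDerivAt (wdzbar f) ((2⁻¹ : ℂ) • ((fderiv ℝ (fderiv ℝ f) z).flip 1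
      + Complex.I • (fderiv ℝ (fderiv ℝ f) z).flip Complex.I)) z := by
  have h := ((aux_fderiv_apply f hf z 1).add
    ((aux_fderiv_apply f hf z Complex.I).const_smul Complex.I)).const_smul (2⁻¹ : ℂ)
  refine h.congr_of_eventuallyEq (Filter.Eventually.of_forall fun w => ?_)
  simp [wdzbar]
  ring

lemma aux_comm (f : ℂ → ℂ) (hf : ContDiff ℝ 2 f) (z : ℂ) :
    wdzbar (wdz f) z = wdz (wdzbar f) z := by
  have hs : IsSymmSndFDerivAt ℝ f z := hf.contDiffAt.isSymmSndFDerivAt (by simp)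
  have := hs.eq 1 Complex.I
  rw [wdzbar, wdz, (aux_wdz f hf z).fderiv, (aux_wdzbar f hf z).fderiv]
  simp [this]
  ring

lemma aux_neg (f : ℂ → ℂ) (z : ℂ) :
    wdz (fun w => - f w) z = - wdz f z ∧ wdzbar (fun w => - f w) z = - wdzbar f z := by
  constructor <;> simp only [wdz, wdzbar, fderiv_fun_neg, neg_apply] <;> ring

lemma aux_exp (u : ℂ → ℝ) (hu : ContDiff ℝ 2 u) (c : ℝ) (k z : ℂ) :
    wdz (fun w => (Real.exp (c * u w) : ℂ) * k) z
      = c * wdz (fun w => (u w : ℂ)) z * (Real.exp (c * u z) : ℂ) * k ∧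
    wdzbar (fun w => (Real.exp (c * u w) : ℂ) * k) z
      = c * wdzbar (fun w => (u w : ℂ)) z * (Real.exp (c * u z) : ℂ) * k := by
  have h0 : HasFDerivAt (fun w => (u w : ℂ)) (fderiv ℝ (fun w => (u w : ℂ)) z) z :=
    ((aux_contDiff u hu).differentiable (by norm_num) z).hasFDerivAt
  have h := ((h0.const_mul (c : ℂ)).cexp).mul_const k
  simp only [wdz, wdzbar]
  push_cast
  rw [h.fderiv]
  constructor <;> simp <;> ring

/-- The zero-curvature equation `∂_z V_ζ + ∂_{z̄} U_ζ = [U_ζ, V_ζ]` holds at a point for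
every `ζ ∈ ℂ*` iff the elliptic sinh-Gordon equation `u_{zz̄} + sinh(4u) = 0` holds there. -/
theorem zero_curvature_iff_sinh_gordon (u : ℂ → ℝ) (hu : ContDiff ℝ 2 u) (z₀ : ℂ) :
    (∀ ζ : ℂ, ζ ≠ 0 → ∀ i j : Fin 2,
        wdz (fun w => Vmat u ζ w i j) z₀ + wdzbar (fun w => Umat u ζ w i j) z₀ =
          (Umat u ζ z₀ * Vmat u ζ z₀ - Vmat u ζ z₀ * Umat u ζ z₀) i j) ↔
      wdz (wdzbar (fun w => (u w : ℂ))) z₀ + (Real.sinh (4 * u z₀) : ℂ) = 0 := by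
  have hf := aux_contDiff u hu
  have hc := aux_comm _ hf z₀
  have hn1 := (aux_neg (wdzbar (fun w => (u w : ℂ))) z₀).1
  have hn2 := (aux_neg (wdz (fun w => (u w : ℂ))) z₀).2
  have hE : (Real.exp (2 * u z₀) : ℂ) * Real.exp (2 * u z₀)
      - (Real.exp (-2 * u z₀) : ℂ) * Real.exp (-2 * u z₀) = 2 * (Real.sinh (4 * u z₀) : ℂ) := by
    rw [← Complex.ofReal_mul, ← Complex.ofReal_mul, ← Complex.ofReal_sub, Real.sinh_eq,
      ← Real.exp_add, ← Real.exp_add, show 2 * u z₀ + 2 * u z₀ = 4 * u z₀ by ring,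
      show -2 * u z₀ + -2 * u z₀ = -(4 * u z₀) by ring]
    push_cast
    ring
  constructor
  · intro h
    have h00 := h 1 one_ne_zero 0 0
    simp only [Umat, Vmat, Matrix.sub_apply, Matrix.mul_apply, Fin.sum_univ_two, Matrix.of_apply,
      Matrix.cons_val', Matrix.cons_val_zero, Matrix.cons_val_one, Matrix.cons_val_fin_one,
      inv_one, mul_one] at h00
    change wdz (wdzbar (fun w => (u w : ℂ))) z₀ + wdzbar (wdz (fun w => (u w : ℂ))) z₀ = _ at h00
    rw [hc] at h00
    linear_combination h00 / 2 - hE / 2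
  · intro h ζ hζ i j
    have hz : ζ * ζ⁻¹ = 1 := mul_inv_cancel₀ hζ
    have e1 := (aux_exp u hu 2 ζ z₀).1
    have e2 := (aux_exp u hu (-2) ζ z₀).1
    have e3 := (aux_exp u hu 2 ζ⁻¹ z₀).2
    have e4 := (aux_exp u hu (-2) ζ⁻¹ z₀).2
    fin_cases i <;> fin_cases j <;>
    simp only [Umat, Vmat, Matrix.sub_apply, Matrix.mul_apply, Fin.sum_univ_two, Matrix.of_apply,
      Matrix.cons_val', Matrix.cons_val_zero, Matrix.cons_val_one, Matrix.cons_val_fin_one,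
      Fin.zero_eta, Fin.mk_one, Fin.isValue]
    · change wdz (wdzbar (fun w => (u w : ℂ))) z₀ + wdzbar (wdz (fun w => (u w : ℂ))) z₀ = _
      rw [hc]
      linear_combination 2 * h + hE + ((Real.exp (2 * u z₀) : ℂ) * Real.exp (2 * u z₀)
        - (Real.exp (-2 * u z₀) : ℂ) * Real.exp (-2 * u z₀)) * hz
    · rw [e1, e4]
      push_cast
      ring
    · rw [e2, e3]
      push_cast
      ring
    · rw [hn1, hn2, hc]
      linear_combination -2 * h - hE - ((Real.exp (2 * u z₀) : ℂ) * Real.exp (2 * u z₀)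
        - (Real.exp (-2 * u z₀) : ℂ) * Real.exp (-2 * u z₀)) * hz
end

section
/- Let r ≥ 1 and let a_1, …, a_r be real numbers with 0 < a_j < 1, and set α_j = √a_j. Define the vector U ∈ ℂ^{2r+1} with coordinates indexed 0, 1, …, 2r by U_0 = −2/(2πi), U_j = −(α_j + α_j^{-1})/(2πi) for 1 ≤ j ≤ r, and U_{r+j} = −i(α_j^{-1} − α_j)/(2πi) for 1 ≤ j ≤ r. Then there exist a complex number z and positive integers p_0, p_1, …, p_r such that z·U + z̄·Ū = (p_0, p_1, …, p_r, 0, …, 0) in ℂ^{2r+1} if and only if there exist positive integers p_0, p_1, …, p_r such that for every j = 1, …, r, either a_j = (p_j/p_0 + √(p_j²/p_0² − 1))² or a_j = (p_j/p_0 − √(p_j²/p_0² − 1))². -/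
/-- The vector `U ∈ ℂ^{2r+1}` with coordinates (indexed `0, 1, …, 2r`)
`U_0 = -2/(2πi)`, `U_j = -(α_j + α_j⁻¹)/(2πi)` and `U_{r+j} = -i(α_j⁻¹ - α_j)/(2πi)`
for `1 ≤ j ≤ r`, where `α_j = √a_j`. -/
noncomputable def bubbleU (r : ℕ) (a : Fin r → ℝ) : Fin (2 * r + 1) → ℂ := fun i =>
  if h0 : i.val = 0 then (-2 : ℂ) / (2 * Real.pi * Complex.I)
  else if h1 : i.val ≤ r then
    -(((Real.sqrt (a ⟨i.val - 1, by omega⟩) +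
        (Real.sqrt (a ⟨i.val - 1, by omega⟩))⁻¹ : ℝ) : ℂ)) / (2 * Real.pi * Complex.I)
  else
    -Complex.I * ((((Real.sqrt (a ⟨i.val - r - 1, by have := i.isLt; omega⟩))⁻¹ -
        Real.sqrt (a ⟨i.val - r - 1, by have := i.isLt; omega⟩) : ℝ) : ℂ)) /
      (2 * Real.pi * Complex.I)

lemma bub_aux1 (z : ℂ) (s : ℝ) :
    z * (-(s : ℂ) / (2 * Real.pi * Complex.I)) +
      (starRingEnd ℂ) z * (starRingEnd ℂ) (-(s : ℂ) / (2 * Real.pi * Complex.I)) =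
      ((-(z.im * s / Real.pi) : ℝ) : ℂ) := by
  have hpi : (Real.pi : ℂ) ≠ 0 := by exact_mod_cast Real.pi_ne_zero
  have e : (-(s : ℂ) / (2 * Real.pi * Complex.I)) = ((s / (2 * Real.pi) : ℝ) : ℂ) * Complex.I := by
    push_cast
    field_simp
    simp
  rw [e, ← map_mul, Complex.add_conj]
  congr 1
  simp only [Complex.mul_re, Complex.mul_im, Complex.ofReal_re, Complex.ofReal_im,
    Complex.I_re, Complex.I_im]
  field_simp
  ring

lemma bub_aux2 (z : ℂ) (s : ℝ) :
    z * (-Complex.I * (s : ℂ) / (2 * Real.pi * Complex.I)) +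
      (starRingEnd ℂ) z * (starRingEnd ℂ) (-Complex.I * (s : ℂ) / (2 * Real.pi * Complex.I)) =
      ((-(z.re * s / Real.pi) : ℝ) : ℂ) := by
  have hpi : (Real.pi : ℂ) ≠ 0 := by exact_mod_cast Real.pi_ne_zero
  have e : (-Complex.I * (s : ℂ) / (2 * Real.pi * Complex.I)) =
      ((-s / (2 * Real.pi) : ℝ) : ℂ) := by
    push_cast
    field_simp
  rw [e, ← map_mul, Complex.add_conj]
  congr 1
  simp only [Complex.mul_re, Complex.mul_im, Complex.ofReal_re, Complex.ofReal_im,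
    Complex.I_re, Complex.I_im]
  field_simp
  ring

lemma bub_fwd (a q : ℝ) (h0 : 0 < a) (h1 : a < 1)
    (hq : q = (Real.sqrt a + (Real.sqrt a)⁻¹) / 2) :
    a = (q - Real.sqrt (q ^ 2 - 1)) ^ 2 := by
  have hb : 0 < Real.sqrt a := Real.sqrt_pos.2 h0
  have hb1 : Real.sqrt a < 1 := by
    rw [Real.sqrt_lt' one_pos]; simpa using h1
  have hi : 1 < (Real.sqrt a)⁻¹ := (one_lt_inv₀ hb).2 hb1
  have hsq := Real.sq_sqrt h0.le
  set b := Real.sqrt a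
  have e : q ^ 2 - 1 = ((b⁻¹ - b) / 2) ^ 2 := by
    rw [hq]; field_simp; ring
  rw [e, Real.sqrt_sq (by linarith), hq, ← hsq]
  ring

lemma bub_bwd (a : ℝ) (h0 : 0 < a) (m n : ℤ) (hm : 0 < m) (hn : 0 < n)
    (h : a = ((m : ℝ) / (n : ℝ) + Real.sqrt ((m : ℝ) ^ 2 / (n : ℝ) ^ 2 - 1)) ^ 2 ∨
        a = ((m : ℝ) / (n : ℝ) - Real.sqrt ((m : ℝ) ^ 2 / (n : ℝ) ^ 2 - 1)) ^ 2) :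
    ∃ k l : ℤ, 0 < k ∧ 0 < l ∧ (Real.sqrt a + (Real.sqrt a)⁻¹) * l = 2 * k := by
  have hm' : (0 : ℝ) < m := by exact_mod_cast hm
  have hn' : (0 : ℝ) < n := by exact_mod_cast hn
  have hq : 0 < (m : ℝ) / n := by positivity
  rw [← div_pow] at h
  by_cases hc : ((m : ℝ) / n) ^ 2 - 1 < 0
  · rw [Real.sqrt_eq_zero_of_nonpos hc.le] at h
    have h' : a = ((m : ℝ) / n) ^ 2 := by rcases h with h | h <;> simpa using h
    refine ⟨m ^ 2 + n ^ 2, 2 * m * n, by positivity, by positivity, ?_⟩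
    rw [h', Real.sqrt_sq hq.le]
    push_cast
    field_simp
  · push Not at hc
    refine ⟨m, n, hm, hn, ?_⟩
    set q := (m : ℝ) / n with hqd
    have hmq : (m : ℝ) = q * n := by rw [hqd]; field_simp
    have ht := Real.sq_sqrt hc
    have ht0 := Real.sqrt_nonneg (q ^ 2 - 1)
    set t := Real.sqrt (q ^ 2 - 1)
    have hlt : t < q := by nlinarith
    have hmul : (q + t) * (q - t) = 1 := by nlinarith
    rw [hmq]
    rcases h with h | h
    · rw [h, Real.sqrt_sq (by linarith), inv_eq_of_mul_eq_one_right hmul]; ring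
    · rw [h, Real.sqrt_sq (by linarith), inv_eq_of_mul_eq_one_left hmul]; ring

/-- The periodicity equation `z·U + z̄·Ū = (p₀, p₁, …, p_r, 0, …, 0)` has a solution with
`z ∈ ℂ` and positive integers `p₀, …, p_r` if and only if there are positive integers
`p₀, …, p_r` with `a_j = (p_j/p₀ ± √(p_j²/p₀² - 1))²` for every `j`. -/
theorem bubbleton_periodicity (r : ℕ) (hr : 1 ≤ r) (a : Fin r → ℝ)
    (ha : ∀ j, 0 < a j ∧ a j < 1) :
    (∃ (z : ℂ) (p : Fin (r + 1) → ℤ), (∀ j, 0 < p j) ∧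
      ∀ i : Fin (2 * r + 1),
        z * bubbleU r a i + (starRingEnd ℂ) z * (starRingEnd ℂ) (bubbleU r a i) =
          if h : i.val < r + 1 then ((p ⟨i.val, h⟩ : ℤ) : ℂ) else 0) ↔
    (∃ p : Fin (r + 1) → ℤ, (∀ j, 0 < p j) ∧
      ∀ j : Fin r,
        a j = ((p j.succ : ℝ) / (p 0 : ℝ) +
            Real.sqrt ((p j.succ : ℝ) ^ 2 / (p 0 : ℝ) ^ 2 - 1)) ^ 2 ∨
        a j = ((p j.succ : ℝ) / (p 0 : ℝ) -
            Real.sqrt ((p j.succ : ℝ) ^ 2 / (p 0 : ℝ) ^ 2 - 1)) ^ 2) := by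
  have hpi := Real.pi_pos
  constructor
  · rintro ⟨z, p, hp, H⟩
    refine ⟨p, hp, fun j => Or.inr ?_⟩
    have H0 := H 0
    have Hj := H ⟨j.val + 1, by omega⟩
    have e0 : bubbleU r a 0 = -((2 : ℝ) : ℂ) / (2 * Real.pi * Complex.I) := by
      simp [bubbleU]
    have ej : bubbleU r a ⟨j.val + 1, by omega⟩ =
        -((Real.sqrt (a j) + (Real.sqrt (a j))⁻¹ : ℝ) : ℂ) / (2 * Real.pi * Complex.I) := by
      have : j.val + 1 ≤ r := j.isLt
      simp [bubbleU, this]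
    rw [e0, bub_aux1, dif_pos (by simp)] at H0
    rw [ej, bub_aux1, dif_pos (by simp)] at Hj
    have H0' : -(z.im * 2 / Real.pi) = (p 0 : ℝ) := by exact_mod_cast H0
    have Hj' : -(z.im * (Real.sqrt (a j) + (Real.sqrt (a j))⁻¹) / Real.pi) = (p j.succ : ℝ) := by
      exact_mod_cast Hj
    have hp0 : (0 : ℝ) < p 0 := by exact_mod_cast hp 0
    rw [← div_pow]
    apply bub_fwd _ _ (ha j).1 (ha j).2
    rw [div_eq_iff hp0.ne', ← H0', ← Hj']
    ring
  · rintro ⟨p, hp, H⟩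
    choose k l hk hl hkl using fun j : Fin r =>
      bub_bwd (a j) (ha j).1 (p j.succ) (p 0) (hp _) (hp _) (H j)
    have hN : 0 < ∏ i, l i := Finset.prod_pos fun i _ => hl i
    have hd : ∀ j, ∃ c, ∏ i, l i = l j * c := fun j =>
      Finset.dvd_prod_of_mem l (Finset.mem_univ j)
    choose c hc using hd
    set N := ∏ i, l i
    have hcp : ∀ j, 0 < c j := fun j => by
      have := hc j ▸ hN
      exact (mul_pos_iff_of_pos_left (hl j)).1 this
    refine ⟨⟨0, -(N * Real.pi / 2)⟩, Fin.cons N fun j => k j * c j, ?_, ?_⟩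
    · intro j
      refine Fin.cases ?_ (fun j => ?_) j
      · simpa using hN
      · simpa using mul_pos (hk j) (hcp j)
    · intro i
      by_cases h0 : i.val = 0
      · have e0 : bubbleU r a i = -((2 : ℝ) : ℂ) / (2 * Real.pi * Complex.I) := by
          simp [bubbleU, h0]
        have ei : (⟨i.val, by omega⟩ : Fin (r + 1)) = 0 := Fin.ext h0
        rw [e0, bub_aux1, dif_pos (by omega), ei, Fin.cons_zero, ← Complex.ofReal_intCast]
        congr 1
        field_simp
      · by_cases h1 : i.val ≤ r
        · obtain ⟨j, hj⟩ : ∃ j : Fin r, i.val = j.val + 1 :=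
            ⟨⟨i.val - 1, by omega⟩, by simp; omega⟩
          have ej : bubbleU r a i =
            -((Real.sqrt (a j) + (Real.sqrt (a j))⁻¹ : ℝ) : ℂ) / (2 * Real.pi * Complex.I) := by
            have hjr : j.val + 1 ≤ r := j.isLt
            simp [bubbleU, hj, hjr]
          have ei : (⟨i.val, by omega⟩ : Fin (r + 1)) = j.succ := Fin.ext (by simpa using hj)
          rw [ej, bub_aux1, dif_pos (by omega), ei, Fin.cons_succ, ← Complex.ofReal_intCast]
          congr 1
          have hN' : (N : ℝ) = l j * c j := by exact_mod_cast hc j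
          have := hkl j
          simp only [hN']
          push_cast
          generalize Real.sqrt (a j) + (Real.sqrt (a j))⁻¹ = s at this ⊢
          field_simp
          linear_combination (c j : ℝ) * this
        · simp only [bubbleU, dif_neg h0, dif_neg h1]
          rw [bub_aux2, dif_neg (by omega)]
          simp
end
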